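/- arXiv:2208.04772 — 2 statements merged into one kernel-verified Lean document; each statement's English description precedes it below -/
import Mathlib

section
/- Let A be a two-sided skew brace. If the group (A,∘) is soluble of derived length n, then the group (A,+) is soluble of derived length at most n+1. -/
/-- A skew (left) brace: a type with two group structures `(A,+)` and `(A,∘)`
(the latter written multiplicatively) sharing the same identity, satisfying the
left skew brace law `a ∘ (b + c) = a ∘ b − a + a ∘ c`. -/
class SkewBrace (A : Type*) extends AddGroup A, Group A where
  mul_add_eq : ∀ a b c : A, a * (b + c) = a * b - a + a * c

namespace SkewBrace

variable {A : Type*}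

/-- A skew brace is two-sided if `(a + b) ∘ c = a ∘ c − c + b ∘ c`. -/
def IsTwoSided (A : Type*) [SkewBrace A] : Prop :=
  ∀ a b c : A, (a + b) * c = a * c - c + b * c

/-- `a * b = −a + a∘b − b`. -/
def bstar [SkewBrace A] (a b : A) : A := -a + a * b - b

/-- the star operation of the opposite skew brace: `a *ₒₚ b = −b + a∘b − a`. -/
def bstarOp [SkewBrace A] (a b : A) : A := -b + a * b - a

/-- `X * Y`: the additive subgroup generated by all `x * y`, `x ∈ X`, `y ∈ Y`. -/
def starSet [SkewBrace A] (X Y : Set A) : AddSubgroup A :=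
  AddSubgroup.closure {z | ∃ x ∈ X, ∃ y ∈ Y, z = bstar x y}

/-- `A² = A * A`. -/
def sq (A : Type*) [SkewBrace A] : AddSubgroup A := starSet Set.univ Set.univ

/-- `A²ₒₚ`, the additive subgroup generated by all `a *ₒₚ b`. -/
def sqOp (A : Type*) [SkewBrace A] : AddSubgroup A :=
  AddSubgroup.closure {z | ∃ a b : A, z = bstarOp a b}

/-- A skew brace is weakly trivial if `A² ∩ A²ₒₚ = {0}`. -/
def IsWeaklyTrivial (A : Type*) [SkewBrace A] : Prop := sq A ⊓ sqOp A = ⊥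

/-- An ideal of a skew brace: an additive subgroup, normal in `(A,+)` and in
`(A,∘)`, and invariant under all `λ_a : b ↦ −a + a∘b`. -/
structure IsIdeal [SkewBrace A] (I : AddSubgroup A) : Prop where
  add_conj : ∀ a : A, ∀ x ∈ I, a + x - a ∈ I
  mul_conj : ∀ a : A, ∀ x ∈ I, a * x * a⁻¹ ∈ I
  lambda_mem : ∀ a : A, ∀ x ∈ I, -a + a * x ∈ I

/-- The left series `A¹ = A`, `Aⁿ⁺¹ = A * Aⁿ`; `leftSeries A n` is `Aⁿ⁺¹`. -/
def leftSeries (A : Type*) [SkewBrace A] : ℕ → AddSubgroup A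
  | 0 => ⊤
  | n + 1 => starSet Set.univ (leftSeries A n : Set A)

/-- The right series `A⁽¹⁾ = A`, `A⁽ⁿ⁺¹⁾ = A⁽ⁿ⁾ * A`; `rightSeries A n` is `A⁽ⁿ⁺¹⁾`. -/
def rightSeries (A : Type*) [SkewBrace A] : ℕ → AddSubgroup A
  | 0 => ⊤
  | n + 1 => starSet (rightSeries A n : Set A) Set.univ

/-- A skew brace is left nilpotent if its left series reaches `{0}`. -/
def IsLeftNilpotent (A : Type*) [SkewBrace A] : Prop := ∃ n, leftSeries A n = ⊥

/-- A skew brace is right nilpotent if its right series reaches `{0}`. -/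
def IsRightNilpotent (A : Type*) [SkewBrace A] : Prop := ∃ n, rightSeries A n = ⊥

/-- The series `A⁽¹⁾ = A`, `A^[n+1]` generated by the union of `A^[i] * A^[n+1-i]`;
`strongSeries A n` is `A^[n+1]`. -/
def strongSeries (A : Type*) [SkewBrace A] : ℕ → AddSubgroup A
  | 0 => ⊤
  | n + 1 => ⨆ i : Fin (n + 1),
      starSet (strongSeries A i.val : Set A) (strongSeries A (n - i.val) : Set A)
  decreasing_by
  · exact i.isLt
  · have := i.isLt; omega

/-- A skew brace is strongly nilpotent if the series `A^[n]` reaches `{0}`. -/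
def IsStronglyNilpotent (A : Type*) [SkewBrace A] : Prop := ∃ n, strongSeries A n = ⊥

/-- The derived series of a skew brace: `A₁ = A`, `Aₙ₊₁ = Aₙ * Aₙ`;
`derivedSeriesBrace A n` is `Aₙ₊₁`. -/
def derivedSeriesBrace (A : Type*) [SkewBrace A] : ℕ → AddSubgroup A
  | 0 => ⊤
  | n + 1 => starSet (derivedSeriesBrace A n : Set A) (derivedSeriesBrace A n : Set A)

/-- A skew brace is soluble if its derived series reaches `{0}`. -/
def IsSolubleBrace (A : Type*) [SkewBrace A] : Prop := ∃ n, derivedSeriesBrace A n = ⊥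

end SkewBrace

theorem SkewBrace.derivedSeries_le_aux {G H : Type*} [Group G] [Group H] (N : Subgroup H)
    [N.Normal] (f : G →* H ⧸ N) (hf : Function.Surjective f) (n : ℕ)
    (hn : derivedSeries G n = ⊥) : derivedSeries H n ≤ N := by
  have h1 : (derivedSeries H n).map (QuotientGroup.mk' N) = ⊥ := by
    rw [map_derivedSeries_eq (QuotientGroup.mk'_surjective N), ← map_derivedSeries_eq hf, hn,
      Subgroup.map_bot]
  rw [Subgroup.map_eq_bot_iff, QuotientGroup.ker_mk'] at h1
  exact h1

/-- A subgroup generated by a set whose conjugates stay inside the subgroup is normal. -/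
theorem SkewBrace.normal_closure_aux {H : Type*} [Group H] (S : Set H)
    (hS : ∀ s ∈ S, ∀ g : H, g * s * g⁻¹ ∈ Subgroup.closure S) : (Subgroup.closure S).Normal := by
  constructor
  intro x hx g
  have : Subgroup.closure S ≤ (Subgroup.closure S).comap (MulAut.conj g).toMonoidHom := by
    rw [Subgroup.closure_le]
    intro s hs
    simpa using hS s hs g
  simpa using this hx

open SkewBrace in
/-- If `A` is a two-sided skew brace whose multiplicative group is soluble of derived
length (at most) `n`, then its additive group is soluble of derived length at most
`n + 1`. -/
theorem additive_solvable_of_multiplicative_solvable (A : Type*) [SkewBrace A]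
    (h : IsTwoSided A) (n : ℕ) (hn : derivedSeries A n = ⊥) :
    derivedSeries (Multiplicative A) (n + 1) = ⊥ := by
  let S : Set (Multiplicative A) := {z | ∃ a b : A, z = Multiplicative.ofAdd (bstar a b)}
  let T : Set (Multiplicative A) := {z | ∃ a b : A, z = Multiplicative.ofAdd (bstarOp a b)}
  have hcomm : ∀ a b c d : A, bstar a d + bstarOp b c = bstarOp b c + bstar a d := by
    intro a b c d
    have e1 : (a + b) * (c + d) = a * c + (bstarOp b c + bstar a d) + b * d := by
      rw [mul_add_eq, h a b c, h a b d]
      simp only [bstar, bstarOp, sub_eq_add_neg, neg_add_rev, add_assoc]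
    have e2 : (a + b) * (c + d) = a * c + (bstar a d + bstarOp b c) + b * d := by
      rw [h, mul_add_eq, mul_add_eq]
      simp only [bstar, bstarOp, sub_eq_add_neg, neg_add_rev, add_assoc]
    rw [e1] at e2
    exact (add_left_cancel (add_right_cancel e2)).symm
  have hNS : (Subgroup.closure S).Normal := by
    apply normal_closure_aux
    rintro s ⟨a, c, rfl⟩ g
    have e : g * Multiplicative.ofAdd (bstar a c) * g⁻¹ =
        (Multiplicative.ofAdd (bstar a g.toAdd))⁻¹ *
          Multiplicative.ofAdd (bstar a (g.toAdd + c)) := by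
      apply Multiplicative.toAdd.injective
      simp only [toAdd_mul, toAdd_inv, toAdd_ofAdd, bstar, mul_add_eq]
      simp only [sub_eq_add_neg, neg_add_rev, add_assoc, neg_neg, add_neg_cancel_left,
        neg_add_cancel_left]
    rw [e]
    exact mul_mem (inv_mem (Subgroup.subset_closure ⟨_, _, rfl⟩))
      (Subgroup.subset_closure ⟨_, _, rfl⟩)
  have hNT : (Subgroup.closure T).Normal := by
    apply normal_closure_aux
    rintro s ⟨a, b, rfl⟩ g
    have e : g * Multiplicative.ofAdd (bstarOp a b) * g⁻¹ =
        Multiplicative.ofAdd (bstarOp a (b + -g.toAdd)) *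
        (Multiplicative.ofAdd (bstarOp a (-g.toAdd)))⁻¹ := by
      apply Multiplicative.toAdd.injective
      simp only [toAdd_mul, toAdd_inv, toAdd_ofAdd, bstarOp, mul_add_eq]
      simp only [sub_eq_add_neg, neg_add_rev, add_assoc, neg_neg, add_neg_cancel_left,
        neg_add_cancel_left]
    rw [e]
    exact mul_mem (Subgroup.subset_closure ⟨_, _, rfl⟩)
      (inv_mem (Subgroup.subset_closure ⟨_, _, rfl⟩))
  have hS : derivedSeries (Multiplicative A) n ≤ Subgroup.closure S := by
    refine derivedSeries_le_aux _ (MonoidHom.mk'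
      (fun a : A => QuotientGroup.mk' (Subgroup.closure S) (Multiplicative.ofAdd a)) ?_) ?_ n hn
    · intro a b
      have e : Multiplicative.ofAdd (a * b) = Multiplicative.ofAdd a *
          Multiplicative.ofAdd (bstar a b) * Multiplicative.ofAdd b := by
        apply Multiplicative.toAdd.injective
        simp [bstar, sub_eq_add_neg, add_assoc]
      have e2 : QuotientGroup.mk' (Subgroup.closure S) (Multiplicative.ofAdd (bstar a b)) = 1 :=
        (QuotientGroup.eq_one_iff _).2 (Subgroup.subset_closure ⟨_, _, rfl⟩)
      rw [e, map_mul, map_mul, e2, mul_one]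
    · intro q
      obtain ⟨x, rfl⟩ := QuotientGroup.mk'_surjective _ q
      exact ⟨x.toAdd, rfl⟩
  have hT : derivedSeries (Multiplicative A) n ≤ Subgroup.closure T := by
    refine derivedSeries_le_aux _ (MonoidHom.mk'
      (fun a : A => (QuotientGroup.mk' (Subgroup.closure T) (Multiplicative.ofAdd a))⁻¹) ?_) ?_
      n hn
    · intro a b
      have e : Multiplicative.ofAdd (a * b) = Multiplicative.ofAdd b *
          Multiplicative.ofAdd (bstarOp a b) * Multiplicative.ofAdd a := by
        apply Multiplicative.toAdd.injective
        simp [bstarOp, sub_eq_add_neg, add_assoc]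
      have e2 : QuotientGroup.mk' (Subgroup.closure T) (Multiplicative.ofAdd (bstarOp a b)) = 1 :=
        (QuotientGroup.eq_one_iff _).2 (Subgroup.subset_closure ⟨_, _, rfl⟩)
      rw [e, map_mul, map_mul, e2, mul_one, mul_inv_rev]
    · intro q
      obtain ⟨x, rfl⟩ := QuotientGroup.mk'_surjective _ q
      refine ⟨(x⁻¹).toAdd, ?_⟩
      show (QuotientGroup.mk' (Subgroup.closure T) (x⁻¹))⁻¹ = _
      rw [map_inv, inv_inv]
  rw [derivedSeries_succ, eq_bot_iff]
  refine (Subgroup.commutator_mono hS hT).trans (le_of_eq ?_)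
  rw [Subgroup.commutator_eq_bot_iff_le_centralizer, Subgroup.centralizer_closure,
    Subgroup.closure_le]
  rintro s ⟨a, d, rfl⟩
  simp only [SetLike.mem_coe]
  rintro t ⟨b, c, rfl⟩
  exact congrArg Multiplicative.ofAdd (hcomm a b c d).symm
end

section
/- Let A be a two-sided skew brace. Then the group (A,+) satisfies the maximum condition on subgroups if and only if the group (A,∘) satisfies the maximum condition on subgroups. -/
theorem wfgt_of_strictMono {X Y : Type*} [PartialOrder X] [PartialOrder Y] [h : WellFoundedGT Y]
    (f : X → Y) (hf : StrictMono f) : WellFoundedGT X :=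
  ⟨Subrelation.wf (fun {_ _} hab => hf hab) (InvImage.wf f h.wf)⟩

theorem wfgt_iff_no_chain {X : Type*} [PartialOrder X] :
    (¬ ∃ f : ℕ → X, StrictMono f) ↔ WellFoundedGT X := by
  constructor
  · intro h
    rw [WellFoundedGT, isWellFounded_iff, RelEmbedding.wellFounded_iff_isEmpty]
    refine ⟨fun g => h ⟨g, fun a b hab => ?_⟩⟩
    exact g.map_rel_iff.2 hab
  · rintro h ⟨f, hf⟩
    exact not_strictMono_of_wellFoundedGT f hf

/-- Extension lemma for the maximal condition. -/
@[to_additive]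
theorem glue_mul_sections {G : Type*} [Group G] (J K I : Subgroup G) [K.Normal] (hJK : J ≤ K)
    (hKI : K ≤ I) (h1 : WellFoundedGT (Set.Icc J K)) (h2 : WellFoundedGT (Set.Icc K I)) :
    WellFoundedGT (Set.Icc J I) := by
  let f : Set.Icc J I → Set.Icc J K × Set.Icc K I := fun H =>
    (⟨H.1 ⊓ K, le_inf H.2.1 hJK, inf_le_right⟩, ⟨H.1 ⊔ K, le_sup_right, sup_le H.2.2 hKI⟩)
  refine wfgt_of_strictMono f ?_
  intro H H' hlt
  have hle : H.1 ≤ H'.1 := hlt.le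
  refine lt_of_le_of_ne ⟨inf_le_inf_right K hle, sup_le_sup_right hle K⟩ ?_
  intro heq
  have e1 : H.1 ⊓ K = H'.1 ⊓ K := congrArg (fun p => (p.1 : Subgroup G)) heq
  have e2 : H.1 ⊔ K = H'.1 ⊔ K := congrArg (fun p => (p.2 : Subgroup G)) heq
  apply hlt.not_ge
  show H'.1 ≤ H.1
  intro x hx
  have hx2 : x ∈ ((H.1 ⊔ K : Subgroup G) : Set G) := by
    rw [e2]; exact Subgroup.mem_sup_left hx
  rw [Subgroup.mul_normal] at hx2
  obtain ⟨a, ha, k, hk, rfl⟩ := hx2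
  have hk' : k ∈ H'.1 := by
    have := H'.1.mul_mem (H'.1.inv_mem (hle ha)) hx
    simpa using this
  have : k ∈ H.1 ⊓ K := by rw [e1]; exact ⟨hk', hk⟩
  exact H.1.mul_mem ha this.1

theorem section_transfer {R G : Type*} [AddGroup R] [Group G] (e : G ≃ R) (he1 : e 1 = 0)
    (J I : AddSubgroup R) (J' I' : Subgroup G) (hJ : ∀ g, g ∈ J' ↔ e g ∈ J)
    (hI : ∀ g, g ∈ I' ↔ e g ∈ I)
    (h1 : (∀ g ∈ I', ∀ h ∈ I', ∃ j ∈ J, e (g * h) = e g + e h + j) ∨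
      (∀ g ∈ I', ∀ h ∈ I', ∃ j ∈ J, e (g * h) = e h + e g + j))
    (h2 : ∀ x : G, ∀ j ∈ J, ∃ k ∈ J', e x + j = e (x * k)) :
    WellFoundedGT (Set.Icc J I) ↔ WellFoundedGT (Set.Icc J' I') := by
  constructor
  · intro hwf
    have key : ∀ H : Set.Icc J' I', ∀ x ∈ H.1, ∀ j ∈ J, e.symm (e x + j) ∈ H.1 := by
      intro H x hx j hj
      obtain ⟨k, hk, hh⟩ := h2 x j hj
      rw [hh, Equiv.symm_apply_apply]
      exact H.1.mul_mem hx (H.2.1 hk)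
    let f : Set.Icc J' I' → Set.Icc J I := fun H => ⟨
      { carrier := {r | e.symm r ∈ H.1}
        zero_mem' := by
          show e.symm 0 ∈ H.1
          rw [← he1, Equiv.symm_apply_apply]; exact H.1.one_mem
        add_mem' := by
          intro a b ha hb
          have ha' : e.symm a ∈ H.1 := ha
          have hb' : e.symm b ∈ H.1 := hb
          show e.symm (a + b) ∈ H.1
          rcases h1 with h1 | h1
          · obtain ⟨j, hj, hh⟩ := h1 _ (H.2.2 ha') _ (H.2.2 hb')
            have := key H _ (H.1.mul_mem ha' hb') (-j) (J.neg_mem hj)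
            rw [hh] at this
            simpa using this
          · obtain ⟨j, hj, hh⟩ := h1 _ (H.2.2 hb') _ (H.2.2 ha')
            have := key H _ (H.1.mul_mem hb' ha') (-j) (J.neg_mem hj)
            rw [hh] at this
            simpa using this
        neg_mem' := by
          intro a ha
          have ha' : e.symm a ∈ H.1 := ha
          show e.symm (-a) ∈ H.1
          rcases h1 with h1 | h1
          · obtain ⟨j, hj, hh⟩ := h1 _ (H.2.2 ha') _ (H.2.2 (H.1.inv_mem ha'))
            have := key H _ (H.1.inv_mem ha') j hj
            rw [mul_inv_cancel, he1, Equiv.apply_symm_apply, add_assoc] at hh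
            rwa [← neg_eq_of_add_eq_zero_right hh.symm] at this
          · obtain ⟨j, hj, hh⟩ := h1 _ (H.2.2 (H.1.inv_mem ha')) _ (H.2.2 ha') 
            have := key H _ (H.1.inv_mem ha') j hj
            rw [inv_mul_cancel, he1, Equiv.apply_symm_apply, add_assoc] at hh
            rwa [← neg_eq_of_add_eq_zero_right hh.symm] at this },
      by
        constructor
        · intro r hr
          exact H.2.1 ((hJ _).2 (by simpa using hr))
        · intro r hr
          have := (hI _).1 (H.2.2 hr)
          simpa using this⟩
    refine wfgt_of_strictMono f ?_
    refine Monotone.strictMono_of_injective ?_ ?_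
    · intro H H' hle r hr
      exact hle hr
    · intro H H' heq
      apply Subtype.ext
      ext g
      have : e g ∈ (f H).1 ↔ e g ∈ (f H').1 := by rw [heq]
      have h3 : e.symm (e g) ∈ H.1 ↔ e.symm (e g) ∈ H'.1 := this
      simpa using h3
  · intro hwf
    let f : Set.Icc J I → Set.Icc J' I' := fun H => ⟨
      { carrier := {g | e g ∈ H.1}
        one_mem' := by
          show e 1 ∈ H.1
          rw [he1]; exact H.1.zero_mem
        mul_mem' := by
          intro a b ha hb
          have ha' : e a ∈ H.1 := ha
          have hb' : e b ∈ H.1 := hb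
          show e (a * b) ∈ H.1
          rcases h1 with h1 | h1
          · obtain ⟨j, hj, hh⟩ := h1 _ ((hI _).2 (H.2.2 ha')) _ ((hI _).2 (H.2.2 hb'))
            rw [hh]
            exact H.1.add_mem (H.1.add_mem ha' hb') (H.2.1 hj)
          · obtain ⟨j, hj, hh⟩ := h1 _ ((hI _).2 (H.2.2 ha')) _ ((hI _).2 (H.2.2 hb'))
            rw [hh]
            exact H.1.add_mem (H.1.add_mem hb' ha') (H.2.1 hj)
        inv_mem' := by
          intro a ha
          have ha' : e a ∈ H.1 := ha
          have haI := (hI _).2 (H.2.2 ha')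
          show e a⁻¹ ∈ H.1
          rcases h1 with h1 | h1
          · obtain ⟨j, hj, hh⟩ := h1 _ haI _ (I'.inv_mem haI)
            rw [mul_inv_cancel, he1, add_assoc] at hh
            have h3 := neg_eq_of_add_eq_zero_right hh.symm
            rw [eq_sub_of_add_eq h3.symm]
            exact H.1.sub_mem (H.1.neg_mem ha') (H.2.1 hj)
          · obtain ⟨j, hj, hh⟩ := h1 _ (I'.inv_mem haI) _ haI
            rw [inv_mul_cancel, he1, add_assoc] at hh
            have h3 := neg_eq_of_add_eq_zero_right hh.symm
            rw [eq_sub_of_add_eq h3.symm]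
            exact H.1.sub_mem (H.1.neg_mem ha') (H.2.1 hj) },
      by
        constructor
        · intro g hg
          exact H.2.1 ((hJ _).1 hg)
        · intro g hg
          exact (hI _).2 (H.2.2 hg)⟩
    refine wfgt_of_strictMono f ?_
    refine Monotone.strictMono_of_injective ?_ ?_
    · intro H H' hle r hr
      exact hle hr
    · intro H H' heq
      apply Subtype.ext
      ext r
      have : e.symm r ∈ (f H).1 ↔ e.symm r ∈ (f H').1 := by rw [heq]
      have h3 : e (e.symm r) ∈ H.1 ↔ e (e.symm r) ∈ H'.1 := this
      simpa using h3

theorem int_isJacobson : IsJacobsonRing ℤ := by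
  rw [isJacobsonRing_iff_prime_eq]
  intro P hP
  by_cases hb : P = ⊥
  · subst hb
    refine le_antisymm ?_ Ideal.le_jacobson
    intro x hx
    rw [Ideal.mem_jacobson_bot] at hx
    have := hx x
    rw [Int.isUnit_iff] at this
    rcases this with h | h
    · have : x = 0 := by nlinarith
      simp [this]
    · nlinarith
  · have := hP.isMaximal hb
    exact Ideal.jacobson_eq_self_of_isMaximal

theorem comm_nil {D : Type*} [CommRing D] [Algebra.FiniteType ℤ D] (x : D)
    (h : ∀ y, IsUnit (x * y + 1)) : IsNilpotent x := by
  have := int_isJacobson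
  have hJ : IsJacobsonRing D := isJacobsonRing_of_finiteType (A := ℤ)
  rw [← Ideal.mem_jacobson_bot, ← Ideal.radical_eq_jacobson] at h
  obtain ⟨n, hn⟩ := h
  exact ⟨n, by simpa using hn⟩

theorem fg_of_acc {G : Type*} [Group G] (K : Subgroup G) (h : WellFoundedGT (Subgroup G)) : K.FG := by
  classical
  let P : Set (Subgroup G) := {H | H ≤ K ∧ H.FG}
  obtain ⟨H, ⟨hHK, hH⟩, hmax⟩ := h.wf.has_min P ⟨⊥, bot_le, ⟨∅, by simp⟩⟩
  suffices K ≤ H by rwa [le_antisymm this hHK]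
  intro k hk
  by_contra hkH
  refine hmax (H ⊔ Subgroup.closure {k}) ⟨sup_le hHK (by simpa using hk), ?_⟩ ?_
  · exact hH.sup ⟨{k}, by simp⟩
  · refine lt_of_le_of_ne le_sup_left fun h => hkH ?_
    rw [h]
    exact Subgroup.mem_sup_right (Subgroup.subset_closure rfl)

theorem nilpotent_of_acc {U : Type*} [Ring U] (R : Submodule ℤ U) (hRR : R * R ≤ R)
    (hnil : ∀ x ∈ R, ∃ n : ℕ, x ^ n = 0)
    (hacc : WellFoundedGT {S : Submodule ℤ U // S ≤ R ∧ S * S ≤ S}) :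
    ∃ n : ℕ, R ^ n = ⊥ := by
  let P : Set {S : Submodule ℤ U // S ≤ R ∧ S * S ≤ S} := {S | ∃ n : ℕ, S.1 ^ n = ⊥}
  have hP : P.Nonempty := ⟨⟨⊥, bot_le, by simp⟩, 1, by simp⟩
  obtain ⟨⟨S, hSR, hSS⟩, ⟨n, hn⟩, hmax⟩ := hacc.wf.has_min P hP
  dsimp only at hn
  by_cases hRS : R ≤ S
  · exact ⟨n, by rw [le_antisymm hRS hSR, hn]⟩
  exfalso
  -- powers
  have hSRi : ∀ i : ℕ, S ^ i * R ≤ R := by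
    intro i
    induction i with
    | zero => simp
    | succ i ih =>
      rw [pow_succ, mul_assoc]
      exact (mul_le_mul' le_rfl ((mul_le_mul' hSR le_rfl).trans hRR)).trans ih
  have hRSi : ∀ i : ℕ, R * S ^ i ≤ R := by
    intro i
    induction i with
    | zero => simp
    | succ i ih =>
      rw [pow_succ', ← mul_assoc]
      exact (mul_le_mul' ((mul_le_mul' le_rfl hSR).trans hRR) le_rfl).trans ih
  have hex : ∃ m : ℕ, ∀ i j : ℕ, i + j = m → S ^ i * R * S ^ j ≤ S := by
    refine ⟨n + n, fun i j hij => ?_⟩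
    rcases le_total n i with h | h
    · rw [← Nat.sub_add_cancel h, pow_add, hn]
      simp
    · have h' : n ≤ j := by omega
      rw [← Nat.sub_add_cancel h', pow_add, hn]
      simp
  obtain ⟨x, hxR, hxS, hSx, hxSS⟩ : ∃ x ∈ R, x ∉ S ∧ (∀ s ∈ S, s * x ∈ S) ∧
      (∀ s ∈ S, x * s ∈ S) := by
    classical
    have hm := Nat.find_spec hex
    have hmin := fun {k} => Nat.find_min hex (m := k)
    generalize Nat.find hex = m at hm hmin
    rcases m with _ | m
    · exact absurd (by simpa using hm 0 0 rfl) hRS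
    · have := hmin (Nat.lt_succ_self m)
      push Not at this
      obtain ⟨i, j, hij, hnot⟩ := this
      obtain ⟨x, hx, hxS⟩ := SetLike.not_le_iff_exists.1 hnot
      refine ⟨x, ?_, hxS, ?_, ?_⟩
      · exact hRSi j ((mul_le_mul' (hSRi i) le_rfl : _ ≤ R * S ^ j) hx)
      · intro s hs
        apply hm (i + 1) j (by omega)
        rw [pow_succ', mul_assoc, mul_assoc, ← mul_assoc (S ^ i)]
        exact Submodule.mul_mem_mul hs hx
      · intro s hs
        apply hm i (j + 1) (by omega)
        rw [pow_succ, ← mul_assoc]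
        exact Submodule.mul_mem_mul hx hs
  -- replace x by a power whose square is in S
  have hpow : ∀ k : ℕ, (∀ s ∈ S, s * x ^ k ∈ S) ∧ (∀ s ∈ S, x ^ k * s ∈ S) := by
    intro k
    induction k with
    | zero => simp
    | succ k ih =>
      refine ⟨fun s hs => ?_, fun s hs => ?_⟩
      · rw [pow_succ, ← mul_assoc]; exact hSx _ (ih.1 s hs)
      · rw [pow_succ', mul_assoc]; exact hxSS _ (ih.2 s hs)
  have hxk : ∀ k : ℕ, x ^ (k + 1) ∈ R := by
    intro k
    induction k with
    | zero => simpa using hxR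
    | succ k ih => rw [pow_succ]; exact hRR (Submodule.mul_mem_mul ih hxR)
  obtain ⟨y, hyR, hyS, hSy, hySS, hyy⟩ : ∃ y ∈ R, y ∉ S ∧ (∀ s ∈ S, s * y ∈ S) ∧
      (∀ s ∈ S, y * s ∈ S) ∧ y * y ∈ S := by
    classical
    have hex2 : ∃ k : ℕ, x ^ (k + 1) ∈ S := by
      obtain ⟨k, hk⟩ := hnil x hxR
      exact ⟨k, by rw [pow_succ, hk]; simp⟩
    have hm := Nat.find_spec hex2
    have hmin := fun {k} => Nat.find_min hex2 (m := k)
    generalize Nat.find hex2 = m at hm hmin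
    rcases m with _ | m
    · exact absurd (by simpa using hm) hxS
    · refine ⟨x ^ (m + 1), hxk m, hmin (Nat.lt_succ_self m), (hpow _).1, (hpow _).2, ?_⟩
      have : x ^ (m + 1) * x ^ (m + 1) = x ^ (m + 1 + 1) * x ^ m := by
        rw [← pow_add, ← pow_add]; congr 1; omega
      rw [this]
      exact (hpow m).1 _ hm
  let Y : Submodule ℤ U := Submodule.span ℤ {y}
  have hTT : (S ⊔ Y) * (S ⊔ Y) ≤ S := by
    rw [Submodule.sup_mul, Submodule.mul_sup, Submodule.mul_sup]
    refine sup_le (sup_le hSS ?_) (sup_le ?_ ?_)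
    · rw [Submodule.mul_le]
      intro s hs z hz
      obtain ⟨c, rfl⟩ := Submodule.mem_span_singleton.1 hz
      rw [mul_smul_comm]; exact S.smul_mem _ (hSy s hs)
    · rw [Submodule.mul_le]
      intro z hz s hs
      obtain ⟨c, rfl⟩ := Submodule.mem_span_singleton.1 hz
      rw [smul_mul_assoc]; exact S.smul_mem _ (hySS s hs)
    · rw [Submodule.mul_le]
      intro z hz s hs
      obtain ⟨c, rfl⟩ := Submodule.mem_span_singleton.1 hz
      obtain ⟨d, rfl⟩ := Submodule.mem_span_singleton.1 hs
      rw [smul_mul_assoc, mul_smul_comm]; exact S.smul_mem _ (S.smul_mem _ hyy)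
  have hTR : S ⊔ Y ≤ R := sup_le hSR (by rw [Submodule.span_singleton_le_iff_mem]; exact hyR)
  refine hmax ⟨S ⊔ Y, hTR, hTT.trans le_sup_left⟩ ⟨2 * n, ?_⟩ ?_
  · rw [eq_bot_iff, ← hn, pow_mul]
    exact pow_le_pow_left' (by rw [pow_two]; exact hTT) n
  · show S < S ⊔ Y
    refine lt_of_le_of_ne le_sup_left fun h => hyS ?_
    rw [h]
    exact Submodule.mem_sup_right (Submodule.mem_span_singleton_self y)

section ringpart

variable {U : Type*} [Ring U] (R : Submodule ℤ U)
  {G : Type*} [Group G] (e : G ≃ R)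

theorem circ_phi (he : ∀ g h, (e (g * h) : U) = e g + e h + e g * e h) (g h : G) :
    (1 + (e g : U)) * (1 + e h) = 1 + e (g * h) := by
  rw [he]; noncomm_ring

theorem ring_nil (hr : ∀ u, ∀ r ∈ R, r * u ∈ R)
    (hdec : ∀ u : U, ∃ n : ℤ, u - n ∈ R) (he1 : e 1 = 0)
    (he : ∀ g h, (e (g * h) : U) = e g + e h + e g * e h)
    (hacc : WellFoundedGT (AddSubgroup R) ∨ WellFoundedGT (Subgroup G)) :
    ∀ x ∈ R, ∃ n : ℕ, x ^ n = 0 := by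
  classical
  intro x hx
  let D : Subring U := Subring.centralizer (Subring.centralizer {x} : Set U)
  have hxC : x ∈ Subring.centralizer {x} := by
    rw [Subring.mem_centralizer_iff]; intro g hg; rw [Set.mem_singleton_iff.1 hg]
  have hxD : x ∈ D := by
    rw [Subring.mem_centralizer_iff]
    intro g hg
    have := (Subring.mem_centralizer_iff.1 hg) x rfl
    exact this.symm
  have hDC : ∀ d ∈ D, d ∈ Subring.centralizer {x} := by
    intro d hd
    rw [Subring.mem_centralizer_iff]
    intro g hg
    rw [Set.mem_singleton_iff.1 hg]
    exact (Subring.mem_centralizer_iff.1 hd) x hxC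
  let _ : CommRing D := { (inferInstance : Ring D) with
    mul_comm := by
      intro a b
      apply Subtype.ext
      exact (Subring.mem_centralizer_iff.1 b.2) a (hDC a a.2) }
  have hinv : ∀ g : G, (1 + (e g : U)) ∈ D → (1 + (e g⁻¹ : U)) ∈ D := by
    intro g hg
    rw [Subring.mem_centralizer_iff] at hg ⊢
    intro c hc
    have h1 : (1 + (e g : U)) * (1 + (e g⁻¹ : U)) = 1 := by
      rw [circ_phi R e he, mul_inv_cancel, he1]; simp
    have h2 : (1 + (e g⁻¹ : U)) * (1 + (e g : U)) = 1 := by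
      rw [circ_phi R e he, inv_mul_cancel, he1]; simp
    have h3 := hg c hc
    calc c * (1 + (e g⁻¹ : U)) = ((1 + (e g⁻¹ : U)) * (1 + (e g : U))) * c * (1 + (e g⁻¹ : U)) := by
          rw [h2, one_mul]
      _ = (1 + (e g⁻¹ : U)) * (c * (1 + (e g : U))) * (1 + (e g⁻¹ : U)) := by
          rw [h3]; simp only [mul_assoc]
      _ = (1 + (e g⁻¹ : U)) * c * ((1 + (e g : U)) * (1 + (e g⁻¹ : U))) := by
          simp only [mul_assoc]
      _ = _ := by rw [h1, mul_one]
  have hunit : ∀ y : D, IsUnit ((⟨x, hxD⟩ : D) * y + 1) := by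
    intro y
    let g : G := e.symm ⟨x * y, hr _ _ hx⟩
    have hg : (1 + (e g : U)) = x * y + 1 := by simp [g, add_comm]
    have hgD : (1 + (e g : U)) ∈ D := by
      rw [hg]; exact D.add_mem (D.mul_mem hxD y.2) D.one_mem
    refine IsUnit.of_mul_eq_one ⟨_, hinv g hgD⟩ ?_
    apply Subtype.ext
    show (x * y + 1) * (1 + (e g⁻¹ : U)) = 1
    rw [← hg, circ_phi R e he, mul_inv_cancel, he1]; simp
  have hft : Algebra.FiniteType ℤ D := by
    rcases hacc with hacc | hacc
    · have hno : IsNoetherian ℤ R := by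
        rw [isNoetherian_iff']
        exact wfgt_of_strictMono (fun S : Submodule ℤ R => S.toAddSubgroup)
          (Submodule.toAddSubgroup_strictMono)
      let φ : D →ₗ[ℤ] U := D.subtype.toAddMonoidHom.toIntLinearMap
      let M : Submodule ℤ D := R.comap φ
      have hMfg : M.FG := by
        let ψ : M →ₗ[ℤ] R := (φ.comp M.subtype).codRestrict R (fun m => m.2)
        have hψ : Function.Injective ψ := by
          intro a b hab
          apply Subtype.ext
          apply Subtype.ext
          exact congrArg (fun r : R => (r : U)) hab
        have : IsNoetherian ℤ M := isNoetherian_of_injective ψ hψ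
        exact (Submodule.fg_top M).1 (IsNoetherian.noetherian ⊤)
      obtain ⟨T, hT⟩ := hMfg
      refine ⟨⟨T, ?_⟩⟩
      rw [eq_top_iff]
      intro d _
      obtain ⟨n, hn⟩ := hdec d
      have hm : d - (n : D) ∈ M := by
        show ((d - (n : D) : D) : U) ∈ R
        simpa using hn
      rw [← hT] at hm
      have h2 := Algebra.span_le_adjoin ℤ (T : Set D) hm
      have h3 := (Algebra.adjoin ℤ (T : Set D)).add_mem h2 (intCast_mem _ n)
      simpa using h3
    · let K : Subgroup G :=
        { carrier := {g | 1 + (e g : U) ∈ D}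
          one_mem' := by show 1 + (e 1 : U) ∈ D; rw [he1]; simp
          mul_mem' := by
            intro a b ha hb
            show 1 + (e (a * b) : U) ∈ D
            rw [← circ_phi R e he]; exact D.mul_mem ha hb
          inv_mem' := by
            intro a ha
            exact hinv a ha }
      let φ : K →* D :=
        { toFun := fun k => ⟨1 + (e k : U), k.2⟩
          map_one' := by apply Subtype.ext; show 1 + (e 1 : U) = 1; rw [he1]; simp
          map_mul' := by
            intro a b
            apply Subtype.ext
            exact (circ_phi R e he a b).symm }
      have hKfg : Monoid.FG K := by
        rw [← Group.fg_iff_monoid_fg, Group.fg_iff_subgroup_fg]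
        exact fg_of_acc K hacc
      obtain ⟨T, hT⟩ := hKfg.fg_top
      refine ⟨⟨T.image φ, ?_⟩⟩
      rw [eq_top_iff]
      intro d _
      obtain ⟨n, hn⟩ := hdec d
      let k : G := e.symm ⟨_, hn⟩
      have hk : (1 + (e k : U)) = ((d - (n : D) + 1 : D) : U) := by simp [k, add_comm]
      have hkK : k ∈ K := by show (1 + (e k : U)) ∈ D; rw [hk]; exact Subtype.property _
      have h2 : φ ⟨k, hkK⟩ ∈ Algebra.adjoin ℤ (T.image φ : Set D) := by
        have : (⊤ : Submonoid K) ≤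
            (Algebra.adjoin ℤ (T.image φ : Set D)).toSubmonoid.comap φ := by
          rw [← hT, Submonoid.closure_le]
          intro t ht
          exact Algebra.subset_adjoin (Finset.mem_coe.2 (Finset.mem_image_of_mem φ ht))
        exact this (Submonoid.mem_top _)
      have h4 : φ ⟨k, hkK⟩ = d - (n : D) + 1 := Subtype.ext hk
      rw [h4] at h2
      have h3 := (Algebra.adjoin ℤ (T.image φ : Set D)).add_mem h2 (intCast_mem _ (n - 1))
      simpa using h3
  obtain ⟨n, hn⟩ := comm_nil (⟨x, hxD⟩ : D) hunit
  exact ⟨n, by simpa using congrArg (Subtype.val) hn⟩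

theorem circ_inv (he1 : e 1 = 0)
    (he : ∀ g h, (e (g * h) : U) = e g + e h + e g * e h) (g : G) :
    (e g⁻¹ : U) = - (e g : U) - e g * e g⁻¹ := by
  have h := he g g⁻¹
  rw [mul_inv_cancel, he1] at h
  have h' : (0 : U) = e g + e g⁻¹ + e g * e g⁻¹ := h
  have h2 : (e g⁻¹ : U) = (e g + e g⁻¹ + e g * e g⁻¹) - (e g : U) - e g * e g⁻¹ := by abel
  rw [← h'] at h2
  simpa using h2

theorem ring_nilpotent (hr : ∀ u, ∀ r ∈ R, r * u ∈ R)
    (hdec : ∀ u : U, ∃ n : ℤ, u - n ∈ R) (he1 : e 1 = 0)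
    (he : ∀ g h, (e (g * h) : U) = e g + e h + e g * e h)
    (hacc : WellFoundedGT (AddSubgroup R) ∨ WellFoundedGT (Subgroup G)) :
    ∃ n : ℕ, R ^ n = ⊥ := by
  have hnil := ring_nil R e hr hdec he1 he hacc
  have hRR : R * R ≤ R := by
    rw [Submodule.mul_le]; intro a ha b _; exact hr b a ha
  refine nilpotent_of_acc R hRR hnil ?_
  rcases hacc with hacc | hacc
  · refine wfgt_of_strictMono (fun S => (S.1.comap R.subtype).toAddSubgroup) ?_
    refine Monotone.strictMono_of_injective ?_ ?_
    · intro S S' hle r hrr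
      exact hle hrr
    · intro S S' heq
      apply Subtype.ext
      ext u
      constructor
      · intro hu
        have h1 : (⟨u, S.2.1 hu⟩ : R) ∈ (S.1.comap R.subtype).toAddSubgroup := hu
        have h2 : (⟨u, S.2.1 hu⟩ : R) ∈ (S'.1.comap R.subtype).toAddSubgroup :=
          (SetLike.ext_iff.1 heq _).1 h1
        exact h2
      · intro hu
        have h1 : (⟨u, S'.2.1 hu⟩ : R) ∈ (S'.1.comap R.subtype).toAddSubgroup := hu
        have h2 : (⟨u, S'.2.1 hu⟩ : R) ∈ (S.1.comap R.subtype).toAddSubgroup :=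
          (SetLike.ext_iff.1 heq _).2 h1
        exact h2
  · let f : {S : Submodule ℤ U // S ≤ R ∧ S * S ≤ S} → Subgroup G := fun S =>
      { carrier := {g | (e g : U) ∈ S.1}
        one_mem' := by show (e 1 : U) ∈ S.1; rw [he1]; simp
        mul_mem' := by
          intro a b ha hb
          show (e (a * b) : U) ∈ S.1
          rw [he]
          exact S.1.add_mem (S.1.add_mem ha hb) (S.2.2 (Submodule.mul_mem_mul ha hb))
        inv_mem' := by
          intro a ha
          have ha' : (e a : U) ∈ S.1 := ha
          show (e a⁻¹ : U) ∈ S.1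
          obtain ⟨n, hn⟩ := hnil (e a) (e a).2
          have hp : ∀ k : ℕ, (e a : U) ^ (k + 1) ∈ S.1 := by
            intro k
            induction k with
            | zero => simpa using ha'
            | succ k ih => rw [pow_succ]; exact S.2.2 (Submodule.mul_mem_mul ih ha')
          have key : ∀ m : ℕ, (e a : U) ^ m * e a⁻¹ ∈ S.1 → (e a⁻¹ : U) ∈ S.1 := by
            intro m
            induction m with
            | zero => intro h; simpa using h
            | succ m ih =>
              intro h
              apply ih
              rw [circ_inv R e he1 he a]
              have : (e a : U) ^ m * (-(e a : U) - e a * e a⁻¹) =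
                  - (e a : U) ^ (m + 1) - (e a : U) ^ (m + 1) * e a⁻¹ := by
                rw [pow_succ]; noncomm_ring
              rw [this]
              exact S.1.sub_mem (S.1.neg_mem (hp m)) h
          exact key n (by rw [hn]; simp) }
    refine wfgt_of_strictMono f ?_
    refine Monotone.strictMono_of_injective ?_ ?_
    · intro S S' hle r hrr
      exact hle hrr
    · intro S S' heq
      apply Subtype.ext
      ext u
      constructor
      · intro hu
        have h1 : e.symm ⟨u, S.2.1 hu⟩ ∈ f S := by
          show (e (e.symm ⟨u, S.2.1 hu⟩) : U) ∈ S.1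
          simpa using hu
        rw [heq] at h1
        have h2 : (e (e.symm ⟨u, S.2.1 hu⟩) : U) ∈ S'.1 := h1
        simpa using h2
      · intro hu
        have h1 : e.symm ⟨u, S'.2.1 hu⟩ ∈ f S' := by
          show (e (e.symm ⟨u, S'.2.1 hu⟩) : U) ∈ S'.1
          simpa using hu
        rw [← heq] at h1
        have h2 : (e (e.symm ⟨u, S'.2.1 hu⟩) : U) ∈ S.1 := h1
        simpa using h2

/-- The subgroup of the circle group attached to a two-sided ideal. -/
def idealSub (he1 : e 1 = 0) (he : ∀ g h, (e (g * h) : U) = e g + e h + e g * e h)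
    (J : Submodule ℤ U) (hJ : ∀ u, ∀ r ∈ J, r * u ∈ J) : Subgroup G where
  carrier := {g | (e g : U) ∈ J}
  one_mem' := by show (e 1 : U) ∈ J; rw [he1]; simp
  mul_mem' := by
    intro a b ha hb
    show (e (a * b) : U) ∈ J
    rw [he]
    exact J.add_mem (J.add_mem ha hb) (hJ _ _ ha)
  inv_mem' := by
    intro a ha
    show (e a⁻¹ : U) ∈ J
    rw [circ_inv R e he1 he]
    exact J.sub_mem (J.neg_mem ha) (hJ _ _ ha)

theorem idealSub_normal (he1 : e 1 = 0) (he : ∀ g h, (e (g * h) : U) = e g + e h + e g * e h)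
    (J : Submodule ℤ U) (hJ : ∀ u, ∀ r ∈ J, r * u ∈ J) (hJ' : ∀ u, ∀ r ∈ J, u * r ∈ J) :
    (idealSub R e he1 he J hJ).Normal := by
  constructor
  intro h hh g
  have hh' : (e h : U) ∈ J := hh
  show (e (g * h * g⁻¹) : U) ∈ J
  have h1 : (1 + (e g : U)) * (1 + (e g⁻¹ : U)) = 1 := by
    rw [circ_phi R e he, mul_inv_cancel, he1]; simp
  have h2 : 1 + (e (g * h * g⁻¹) : U) = 1 + (1 + (e g : U)) * e h * (1 + (e g⁻¹ : U)) := by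
    have aux : ∀ a b c : U, a * c = 1 → a * (1 + b) * c = 1 + a * b * c := by
      intro a b c h
      rw [mul_add, mul_one, add_mul, h]
    rw [← circ_phi R e he, ← circ_phi R e he, aux _ _ _ h1]
  rw [add_left_cancel h2]
  exact hJ _ _ (hJ' _ _ hh')

theorem ring_max (hl : ∀ u, ∀ r ∈ R, u * r ∈ R) (hr : ∀ u, ∀ r ∈ R, r * u ∈ R)
    (hdec : ∀ u : U, ∃ n : ℤ, u - n ∈ R) (he1 : e 1 = 0)
    (he : ∀ g h, (e (g * h) : U) = e g + e h + e g * e h) :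
    WellFoundedGT (AddSubgroup R) ↔ WellFoundedGT (Subgroup G) := by
  have hRl : ∀ k : ℕ, ∀ u, ∀ r ∈ R ^ (k + 1), u * r ∈ R ^ (k + 1) := by
    intro k u r hrr
    rw [pow_succ'] at hrr ⊢
    induction hrr using Submodule.mul_induction_on' with
    | mem_mul_mem a ha b hb =>
      rw [← mul_assoc]; exact Submodule.mul_mem_mul (hl _ _ ha) hb
    | add a _ b _ h1 h2 => rw [mul_add]; exact Submodule.add_mem _ h1 h2
  have hRr : ∀ k : ℕ, ∀ u, ∀ r ∈ R ^ (k + 1), r * u ∈ R ^ (k + 1) := by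
    intro k u r hrr
    rw [pow_succ] at hrr ⊢
    induction hrr using Submodule.mul_induction_on' with
    | mem_mul_mem a ha b hb =>
      rw [mul_assoc]; exact Submodule.mul_mem_mul ha (hr _ _ hb)
    | add a _ b _ h1 h2 => rw [add_mul]; exact Submodule.add_mem _ h1 h2
  let P : ℕ → AddSubgroup R := fun k => ((R ^ (k + 1)).comap R.subtype).toAddSubgroup
  let Q : ℕ → Subgroup G := fun k => idealSub R e he1 he (R ^ (k + 1)) (hRr k)
  have memP : ∀ k r, r ∈ P k ↔ (r : U) ∈ R ^ (k + 1) := fun k r => Iff.rfl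
  have memQ : ∀ k g, g ∈ Q k ↔ (e g : U) ∈ R ^ (k + 1) := fun k r => Iff.rfl
  have hQn : ∀ k, (Q k).Normal := fun k => idealSub_normal R e he1 he _ _ (hRl k)
  have hdesc : ∀ k, R ^ (k + 1 + 1) ≤ R ^ (k + 1) := by
    intro k
    rw [pow_succ _ (k + 1), Submodule.mul_le]
    intro a ha b _
    exact hRr k b a ha
  have hPd : ∀ k, P (k + 1) ≤ P k := fun k r hrr => hdesc k hrr
  have hQd : ∀ k, Q (k + 1) ≤ Q k := fun k r hrr => hdesc k hrr
  have hP0 : P 0 = ⊤ := by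
    rw [eq_top_iff]; intro r _; rw [memP]; simp
  have hQ0 : Q 0 = ⊤ := by
    rw [eq_top_iff]; intro r _; rw [memQ]; simp
  have hsec : ∀ k, WellFoundedGT (Set.Icc (P (k + 1)) (P k)) ↔
      WellFoundedGT (Set.Icc (Q (k + 1)) (Q k)) := by
    intro k
    refine section_transfer e he1 _ _ _ _ (fun g => Iff.rfl) (fun g => Iff.rfl) (Or.inl ?_) ?_
    · intro g hg h hh
      refine ⟨⟨e g * e h, hr _ _ (e g).2⟩, ?_, ?_⟩
      · rw [memP, pow_succ]
        exact Submodule.mul_mem_mul hg (e h).2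
      · apply Subtype.ext
        exact he g h
    · intro x j hj
      refine ⟨x⁻¹ * e.symm (e x + j), ?_, by simp⟩
      rw [memQ, he]
      have h1 := he x⁻¹ x
      rw [inv_mul_cancel, he1] at h1
      have h1' : (e x⁻¹ : U) + e x + e x⁻¹ * e x = 0 := h1.symm
      have h2 : (e x⁻¹ : U) + (e (e.symm (e x + j)) : U) + e x⁻¹ * e (e.symm (e x + j))
        = j + e x⁻¹ * j := by
        rw [Equiv.apply_symm_apply]
        push_cast
        rw [← zero_add ((j : U) + e x⁻¹ * j), ← h1', mul_add]
        abel
      rw [h2]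
      exact Submodule.add_mem _ hj (hRl _ _ _ hj)
  constructor
  · intro hacc
    obtain ⟨n, hn⟩ := ring_nilpotent R e hr hdec he1 he (Or.inl hacc)
    have hall : ∀ k, WellFoundedGT (Set.Icc (Q k) ⊤) := by
      intro k
      induction k with
      | zero => rw [hQ0, Set.Icc_self]; infer_instance
      | succ k ih =>
        have := hQn k
        exact glue_mul_sections _ (Q k) _ (hQd k) le_top ((hsec k).1 inferInstance) ih
    have hQb : Q n = ⊥ := by
      rw [eq_bot_iff]
      intro g hg
      rw [memQ, pow_succ, hn] at hg
      have h0 : (e g : U) = 0 := by simpa using hg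
      have h1 : e g = e 1 := by rw [he1]; exact Subtype.ext h0
      exact Subgroup.mem_bot.2 (e.injective h1)
    have := hall n
    rw [hQb] at this
    exact wfgt_of_strictMono (fun H : Subgroup G => (⟨H, bot_le, le_top⟩ : Set.Icc ⊥ ⊤))
      (fun _ _ h => h)
  · intro hacc
    obtain ⟨n, hn⟩ := ring_nilpotent R e hr hdec he1 he (Or.inr hacc)
    have hall : ∀ k, WellFoundedGT (Set.Icc (P k) ⊤) := by
      intro k
      induction k with
      | zero => rw [hP0, Set.Icc_self]; infer_instance
      | succ k ih =>
        exact glue_add_sections _ (P k) _ (hPd k) le_top ((hsec k).2 inferInstance) ih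
    have hPb : P n = ⊥ := by
      rw [eq_bot_iff]
      intro g hg
      rw [memP, pow_succ, hn] at hg
      have h0 : (g : U) = 0 := by simpa using hg
      exact AddSubgroup.mem_bot.2 (Subtype.ext h0)
    have := hall n
    rw [hPb] at this
    exact wfgt_of_strictMono (fun H : AddSubgroup R => (⟨H, bot_le, le_top⟩ : Set.Icc ⊥ ⊤))
      (fun _ _ h => h)

end ringpart

theorem nonunital_max_aux {R : Type*} [NonUnitalRing R] {G : Type*} [Group G] (e : G ≃ R)
    (he1 : e 1 = 0) (he : ∀ g h, e (g * h) = e g + e h + e g * e h)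
    {U : Type*} [Ring U] (ι : R →+ U) (hι : Function.Injective ι)
    (hmul : ∀ a b, ι (a * b) = ι a * ι b)
    (hl : ∀ u : U, ∀ r ∈ ι.range, u * r ∈ ι.range) (hr : ∀ u : U, ∀ r ∈ ι.range, r * u ∈ ι.range)
    (hdec : ∀ u : U, ∃ n : ℤ, u - n ∈ ι.range) :
    WellFoundedGT (AddSubgroup R) ↔ WellFoundedGT (Subgroup G) := by
  let M : Submodule ℤ U := AddSubgroup.toIntSubmodule ι.range
  let ε : R ≃ M := Equiv.ofBijective (fun r => (⟨ι r, ⟨r, rfl⟩⟩ : M)) (by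
    constructor
    · intro a b hab
      exact hι (congrArg (fun m : M => (m : U)) hab)
    · rintro ⟨_, r, rfl⟩
      exact ⟨r, rfl⟩)
  have hε : ∀ r, ((ε r : M) : U) = ι r := fun r => rfl
  let εa : R ≃+ M := { ε with
    map_add' := by
      intro a b
      apply Subtype.ext
      exact ι.map_add a b }
  have main := ring_max M (e.trans ε) hl hr hdec ?_ ?_
  · rw [← main]
    constructor
    · intro h
      exact wfgt_of_strictMono (AddSubgroup.comap εa.toAddMonoidHom)
        (Monotone.strictMono_of_injective (fun _ _ h => AddSubgroup.comap_mono h)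
          (AddSubgroup.comap_injective εa.surjective))
    · intro h
      exact wfgt_of_strictMono (AddSubgroup.map εa.toAddMonoidHom)
        (Monotone.strictMono_of_injective (fun _ _ h => AddSubgroup.map_mono h)
          (AddSubgroup.map_injective εa.injective))
  · apply Subtype.ext
    rw [Equiv.trans_apply, hε, he1]
    exact ι.map_zero
  · intro g h
    simp only [Equiv.trans_apply, hε]
    rw [he, map_add, map_add, hmul]

theorem nonunital_max {R : Type*} [NonUnitalRing R] {G : Type*} [Group G] (e : G ≃ R)
    (he1 : e 1 = 0) (he : ∀ g h, e (g * h) = e g + e h + e g * e h) :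
    WellFoundedGT (AddSubgroup R) ↔ WellFoundedGT (Subgroup G) := by
  let ι : R →+ Unitization ℤ R :=
    { toFun := fun r => (r : Unitization ℤ R)
      map_zero' := Unitization.inr_zero ℤ
      map_add' := Unitization.inr_add ℤ }
  have memM : ∀ u, u ∈ ι.range ↔ u.fst = 0 := by
    intro u
    constructor
    · rintro ⟨r, rfl⟩
      exact Unitization.fst_inr ℤ r
    · intro h
      refine ⟨u.snd, ?_⟩
      apply Unitization.ext
      · exact (Unitization.fst_inr ℤ _).trans h.symm
      · exact Unitization.snd_inr ℤ _
  have hm : ∀ a b, ι (a * b) = ι a * ι b := fun a b => Unitization.inr_mul ℤ a b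
  have hi : Function.Injective ι := Unitization.inr_injective
  refine nonunital_max_aux (U := Unitization ℤ R) e he1 he ι hi hm ?_ ?_ ?_
  · intro u r hr
    rw [memM] at hr ⊢
    simp [hr]
  · intro u r hr
    rw [memM] at hr ⊢
    simp [hr]
  · intro u
    refine ⟨u.fst, ?_⟩
    rw [memM]
    have h : Unitization.fstHom ℤ R (u - (u.fst : ℤ)) = 0 := by
      rw [map_sub, map_intCast]
      simp
    exact h

theorem closure_sub_normal {A ι : Type*} [AddGroup A] (F : ι → A → A)
    (hF : ∀ i x y, F i (x + y) = F i x + F i y) (S : Set A)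
    (hS : ∀ z, z ∈ S ↔ ∃ i x, z = F i x - x) : (AddSubgroup.closure S).Normal := by
  constructor
  intro z hz c
  induction hz using AddSubgroup.closure_induction with
  | mem z hz =>
    obtain ⟨i, x, rfl⟩ := (hS _).1 hz
    have h1 : F i c - c ∈ S := (hS _).2 ⟨i, c, rfl⟩
    have h2 : F i (c + x) - (c + x) ∈ S := (hS _).2 ⟨i, c + x, rfl⟩
    have h3 : c + (F i x - x) + -c = -(F i c - c) + (F i (c + x) - (c + x)) := by
      rw [hF]
      simp only [sub_eq_add_neg, neg_add_rev, neg_neg, add_assoc, neg_add_cancel_left]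
    rw [h3]
    exact AddSubgroup.add_mem _ (AddSubgroup.neg_mem _ (AddSubgroup.subset_closure h1))
      (AddSubgroup.subset_closure h2)
  | zero => simp
  | add x y _ _ hx hy =>
    have : c + (x + y) + -c = (c + x + -c) + (c + y + -c) := by
      simp only [add_assoc, neg_add_cancel_left]
    rw [this]
    exact AddSubgroup.add_mem _ hx hy
  | neg x _ hx =>
    have : c + -x + -c = -(c + x + -c) := by
      simp only [neg_add_rev, neg_neg, add_assoc]
    rw [this]
    exact AddSubgroup.neg_mem _ hx

namespace SkewBrace

variable {A : Type*} [SkewBrace A]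

theorem mul_zero_eq (a : A) : a * 0 = a := by
  have h := mul_add_eq a 0 0
  rw [add_zero, sub_eq_add_neg, add_assoc] at h
  have h2 : -a + a * 0 = 0 := by simpa using h.symm
  exact (neg_add_eq_zero.1 h2).symm

theorem one_eq_zero' : (1 : A) = 0 := by
  have h := mul_zero_eq (1 : A)
  rw [one_mul] at h
  exact h.symm

theorem lam_add (a x y : A) : -a + a * (x + y) = (-a + a * x) + (-a + a * y) := by
  rw [mul_add_eq]; simp only [sub_eq_add_neg, add_assoc]

theorem mu_add (h : IsTwoSided A) (b x y : A) :
    -b + (x + y) * b = (-b + x * b) + (-b + y * b) := by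
  rw [h]; simp only [sub_eq_add_neg, add_assoc]

theorem sq_normal : (sq A).Normal := by
  refine closure_sub_normal (fun a x : A => -a + a * x) lam_add _ ?_
  intro z
  constructor
  · rintro ⟨x, -, y, -, rfl⟩
    exact ⟨x, y, rfl⟩
  · rintro ⟨x, y, rfl⟩
    exact ⟨x, trivial, y, trivial, rfl⟩

theorem sqOp_normal (h : IsTwoSided A) : (sqOp A).Normal := by
  refine closure_sub_normal (fun b x : A => -b + x * b) (mu_add h) _ ?_
  intro z
  constructor
  · rintro ⟨x, y, rfl⟩
    exact ⟨y, x, rfl⟩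
  · rintro ⟨x, y, rfl⟩
    exact ⟨y, x, rfl⟩

theorem sq_mem (a b : A) : -b - a + a * b ∈ sq A := by
  have h1 : bstar a b ∈ sq A := AddSubgroup.subset_closure ⟨a, trivial, b, trivial, rfl⟩
  have h2 := sq_normal.conj_mem _ h1 (-b)
  have h3 : -b + bstar a b + -(-b) = -b - a + a * b := by
    simp [bstar, sub_eq_add_neg, add_assoc]
  rwa [h3] at h2

theorem sqOp_mem (h : IsTwoSided A) (a b : A) : -a - b + a * b ∈ sqOp A := by
  have h1 : bstarOp a b ∈ sqOp A := AddSubgroup.subset_closure ⟨a, b, rfl⟩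
  have h2 := (sqOp_normal h).conj_mem _ h1 (-a)
  have h3 : -a + bstarOp a b + -(-a) = -a - b + a * b := by
    simp [bstarOp, sub_eq_add_neg, add_assoc]
  rwa [h3] at h2

theorem ker_ideal {B : Type*} [AddGroup B] (π : A →+ B)
    (hπ : (∀ a b, π (a * b) = π a + π b) ∨ (∀ a b, π (a * b) = π b + π a)) :
    IsIdeal π.ker := by
  refine ⟨?_, ?_, ?_⟩
  · intro a x hx
    rw [AddMonoidHom.mem_ker] at hx ⊢
    simp [hx]
  · intro a x hx
    rw [AddMonoidHom.mem_ker] at hx ⊢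
    rcases hπ with hπ | hπ
    · rw [hπ, hπ, hx, add_zero, ← hπ, mul_inv_cancel, one_eq_zero', map_zero]
    · rw [hπ, hπ, hx, zero_add, ← hπ, mul_inv_cancel, one_eq_zero', map_zero]
  · intro a x hx
    rw [AddMonoidHom.mem_ker] at hx ⊢
    rcases hπ with hπ | hπ
    · rw [map_add, map_neg, hπ, hx]; simp
    · rw [map_add, map_neg, hπ, hx]; simp

theorem sq_ideal : IsIdeal (sq A) := by
  have := sq_normal (A := A)
  have h := ker_ideal (QuotientAddGroup.mk' (sq A)) (Or.inl ?_)
  · rwa [QuotientAddGroup.ker_mk'] at h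
  · intro a b
    have h1 := sq_mem a b
    rw [← map_add]
    symm
    rw [QuotientAddGroup.mk'_eq_mk']
    refine ⟨_, h1, ?_⟩
    simp [sub_eq_add_neg, add_assoc]

theorem sqOp_ideal (ht : IsTwoSided A) : IsIdeal (sqOp A) := by
  have := sqOp_normal ht
  have h := ker_ideal (QuotientAddGroup.mk' (sqOp A)) (Or.inr ?_)
  · rwa [QuotientAddGroup.ker_mk'] at h
  · intro a b
    have h1 := sqOp_mem ht a b
    rw [← map_add]
    symm
    rw [QuotientAddGroup.mk'_eq_mk']
    refine ⟨_, h1, ?_⟩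
    simp [sub_eq_add_neg, add_assoc]

theorem IsIdeal.inf {I J : AddSubgroup A} (hI : IsIdeal I) (hJ : IsIdeal J) :
    IsIdeal (I ⊓ J) :=
  ⟨fun a x hx => ⟨hI.1 a x hx.1, hJ.1 a x hx.2⟩,
   fun a x hx => ⟨hI.2 a x hx.1, hJ.2 a x hx.2⟩,
   fun a x hx => ⟨hI.3 a x hx.1, hJ.3 a x hx.2⟩⟩

/-- The multiplicative subgroup underlying an ideal. -/
def IsIdeal.toSub {I : AddSubgroup A} (hI : IsIdeal I) : Subgroup A where
  carrier := I
  one_mem' := by rw [one_eq_zero']; exact I.zero_mem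
  mul_mem' := by
    intro a b ha hb
    have h1 : a * b = a + (-a + a * b) := by simp
    rw [h1]
    exact I.add_mem ha (hI.lambda_mem a b hb)
  inv_mem' := by
    intro a ha
    have h1 := hI.lambda_mem a⁻¹ a ha
    rw [inv_mul_cancel, one_eq_zero', add_zero] at h1
    simpa using h1

theorem IsIdeal.toSub_normal {I : AddSubgroup A} (hI : IsIdeal I) : hI.toSub.Normal :=
  ⟨fun x hx a => hI.mul_conj a x hx⟩

theorem IsIdeal.add_normal {I : AddSubgroup A} (hI : IsIdeal I) : I.Normal :=
  ⟨fun x hx a => by rw [← sub_eq_add_neg]; exact hI.add_conj a x hx⟩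

theorem IsIdeal.shift {I : AddSubgroup A} (hI : IsIdeal I) (x : A) (j : A) (hj : j ∈ I) :
    ∃ k ∈ hI.toSub, x + j = x * k := by
  refine ⟨x⁻¹ * (x + j), ?_, by simp⟩
  have h1 := hI.lambda_mem x⁻¹ j hj
  rw [mul_add_eq, inv_mul_cancel, one_eq_zero', zero_sub]
  exact h1

theorem star_comm (ht : IsTwoSided A) (a b c d : A) :
    bstar a d + bstarOp b c = bstarOp b c + bstar a d := by
  have h1 : (a + b) * (c + d) = a * c + (bstarOp b c + bstar a d) + b * d := by
    rw [mul_add_eq, ht, ht, bstar, bstarOp]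
    simp only [sub_eq_add_neg, neg_add_rev, add_assoc]
  have h2 : (a + b) * (c + d) = a * c + (bstar a d + bstarOp b c) + b * d := by
    rw [ht, mul_add_eq, mul_add_eq, bstar, bstarOp]
    simp only [sub_eq_add_neg, neg_add_rev, add_assoc]
  rw [h1] at h2
  exact (add_left_cancel (add_right_cancel h2)).symm

theorem sq_comm_sqOp (ht : IsTwoSided A) (x y : A) (hx : x ∈ sq A) (hy : y ∈ sqOp A) :
    x + y = y + x := by
  have h1 : sq A ≤ AddSubgroup.centralizer (sqOp A : Set A) := by
    refine (AddSubgroup.closure_le _).2 ?_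
    rintro _ ⟨a, -, d, -, rfl⟩
    rw [sqOp, AddSubgroup.centralizer_closure]
    rw [SetLike.mem_coe, AddSubgroup.mem_centralizer_iff]
    rintro _ ⟨b, c, rfl⟩
    exact (star_comm ht a b c d).symm
  exact ((AddSubgroup.mem_centralizer_iff.1 (h1 hx)) y hy).symm

theorem bstar_mem {I : AddSubgroup A} (hI : IsIdeal I) {a b : A} (ha : a ∈ I) (hb : b ∈ I) :
    -a + a * b - b ∈ I :=
  I.sub_mem (I.add_mem (I.neg_mem ha) (hI.toSub.mul_mem ha hb)) hb

/-- An additively commutative ideal of a two-sided skew brace is a (radical) ring. -/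
@[reducible] def idealRing (ht : IsTwoSided A) {I : AddSubgroup A} (hI : IsIdeal I)
    (hc : ∀ x ∈ I, ∀ y ∈ I, x + y = y + x) : NonUnitalRing I :=
  let acg : AddCommGroup I := { (inferInstance : AddGroup I) with
    add_comm := fun a b => Subtype.ext (hc a a.2 b b.2) }
  let m : Mul I := ⟨fun a b => ⟨-(a : A) + a * b - b, bstar_mem hI a.2 b.2⟩⟩
  let c : I → I → I := fun a b => ⟨(a : A) * b, hI.toSub.mul_mem a.2 b.2⟩
  have hm : ∀ a b : I, a * b = -a + c a b - b := fun a b => rfl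
  have cl : ∀ x y z : I, c x (y + z) = c x y - x + c x z := fun x y z =>
    Subtype.ext (mul_add_eq (x : A) y z)
  have cr : ∀ x y z : I, c (x + y) z = c x z - z + c y z := fun x y z =>
    Subtype.ext (ht (x : A) y z)
  have ca : ∀ x y z : I, c (c x y) z = c x (c y z) := fun x y z =>
    Subtype.ext (mul_assoc (x : A) y z)
  have ld : ∀ a b d : I, a * (b + d) = a * b + a * d := by
    intro a b d
    rw [hm, hm, hm, cl]; abel
  have rd : ∀ a b d : I, (a + b) * d = a * d + b * d := by
    intro a b d
    rw [hm, hm, hm, cr]; abel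
  have hcm : ∀ a b : I, c a b = a + b + a * b := by
    intro a b; rw [hm]; abel
  { acg, m with
    left_distrib := ld
    right_distrib := rd
    zero_mul := by
      intro a
      have h := rd 0 0 a
      rw [add_zero] at h
      exact (left_eq_add.1 h)
    mul_zero := by
      intro a
      have h := ld a 0 0
      rw [add_zero] at h
      exact (left_eq_add.1 h)
    mul_assoc := by
      intro x y z
      have h := ca x y z
      rw [hcm x y, hcm, hcm y z, hcm] at h
      simp only [ld, rd] at h
      have h2 : (x + y + x * y) + z + (x * z + y * z + x * y * z) =
        (x + y + z + x * y + x * z + y * z) + x * y * z := by abel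
      have h3 : x + (y + z + y * z) + (x * y + x * z + x * (y * z)) =
        (x + y + z + x * y + x * z + y * z) + x * (y * z) := by abel
      rw [h2, h3] at h
      exact add_left_cancel h }

theorem ideal_max (ht : IsTwoSided A) {I : AddSubgroup A} (hI : IsIdeal I)
    (hc : ∀ x ∈ I, ∀ y ∈ I, x + y = y + x) :
    WellFoundedGT (AddSubgroup I) ↔ WellFoundedGT (Subgroup hI.toSub) := by
  let _ : NonUnitalRing I := idealRing ht hI hc
  let e : hI.toSub ≃ I := ⟨fun x => ⟨x.1, x.2⟩, fun x => ⟨x.1, x.2⟩, fun _ => rfl, fun _ => rfl⟩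
  refine nonunital_max e ?_ ?_
  · exact Subtype.ext one_eq_zero'
  · intro g h
    apply Subtype.ext
    show (g.1 * h.1 : A) = g.1 + h.1 + (-g.1 + g.1 * h.1 - h.1)
    have h1 : g.1 + h.1 = h.1 + g.1 := hc _ g.2 _ h.2
    have h2 : -g.1 + g.1 * h.1 - h.1 ∈ I := bstar_mem hI g.2 h.2
    rw [h1, hc _ (I.add_mem h.2 g.2) _ h2]
    have h3 : -g.1 + g.1 * h.1 - h.1 + (h.1 + g.1) = -g.1 + g.1 * h.1 + g.1 := by
      simp [sub_eq_add_neg, add_assoc]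
    rw [h3, hc _ (I.add_mem (I.neg_mem g.2) (hI.toSub.mul_mem g.2 h.2)) _ g.2]
    simp

end SkewBrace

@[to_additive]
theorem wf_mul_Icc_iff {G : Type*} [Group G] (K : Subgroup G) :
    WellFoundedGT (Set.Icc ⊥ K) ↔ WellFoundedGT (Subgroup K) := by
  constructor
  · intro h
    refine wfgt_of_strictMono (fun H : Subgroup K =>
      (⟨H.map K.subtype, bot_le, Subgroup.map_subtype_le H⟩ : Set.Icc ⊥ K)) ?_
    refine Monotone.strictMono_of_injective (fun _ _ h => Subgroup.map_mono h) ?_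
    intro H H' heq
    exact Subgroup.map_injective K.subtype_injective (congrArg Subtype.val heq)
  · intro h
    refine wfgt_of_strictMono (fun H : Set.Icc ⊥ K => H.1.subgroupOf K) ?_
    refine Monotone.strictMono_of_injective (fun _ _ h => Subgroup.comap_mono h) ?_
    intro H H' heq
    apply Subtype.ext
    have h2 := Subgroup.subgroupOf_inj.1 heq
    rwa [inf_eq_left.2 H.2.2, inf_eq_left.2 H'.2.2] at h2

open SkewBrace in
theorem max_wf_iff (A : Type*) [SkewBrace A] (ht : IsTwoSided A) :
    WellFoundedGT (AddSubgroup A) ↔ WellFoundedGT (Subgroup A) := by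
  have hS : IsIdeal (sq A) := sq_ideal
  have hO : IsIdeal (sqOp A) := sqOp_ideal ht
  have hN : IsIdeal (sq A ⊓ sqOp A) := hS.inf hO
  have s1 : WellFoundedGT (Set.Icc (sq A) ⊤) ↔ WellFoundedGT (Set.Icc hS.toSub ⊤) := by
    refine section_transfer (Equiv.refl A) one_eq_zero' _ _ _ _ (fun g => Iff.rfl)
      (fun g => by simp) (Or.inl ?_) hS.shift
    intro g _ h _
    exact ⟨_, sq_mem g h, by simp [sub_eq_add_neg, add_assoc]⟩
  have s2 : WellFoundedGT (Set.Icc (sq A ⊓ sqOp A) (sq A)) ↔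
      WellFoundedGT (Set.Icc hN.toSub hS.toSub) := by
    refine section_transfer (Equiv.refl A) one_eq_zero' _ _ _ _ (fun g => Iff.rfl)
      (fun g => Iff.rfl) (Or.inr ?_) hN.shift
    intro g hg h hh
    have hg' : g ∈ sq A := hg
    have hh' : h ∈ sq A := hh
    refine ⟨-g - h + g * h, ⟨?_, sqOp_mem ht g h⟩, by simp [sub_eq_add_neg, add_assoc]⟩
    exact (sq A).add_mem ((sq A).sub_mem ((sq A).neg_mem hg') hh') (hS.toSub.mul_mem hg hh)
  have s3 : WellFoundedGT (Set.Icc ⊥ (sq A ⊓ sqOp A)) ↔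
      WellFoundedGT (Set.Icc ⊥ hN.toSub) := by
    rw [wf_add_Icc_iff, wf_mul_Icc_iff]
    exact ideal_max ht hN (fun x hx y hy => sq_comm_sqOp ht x y hx.1 hy.2)
  have n1 := hS.add_normal
  have n2 := hN.add_normal
  have n3 := hS.toSub_normal
  have n4 := hN.toSub_normal
  have hle : hN.toSub ≤ hS.toSub := fun x hx => hx.1
  constructor
  · intro h
    have := glue_mul_sections ⊥ hN.toSub ⊤ bot_le le_top (s3.1 inferInstance)
      (glue_mul_sections _ hS.toSub ⊤ hle le_top (s2.1 inferInstance) (s1.1 inferInstance))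
    exact wfgt_of_strictMono (fun H : Subgroup A => (⟨H, bot_le, le_top⟩ : Set.Icc ⊥ ⊤))
      (fun _ _ h => h)
  · intro h
    have := glue_add_sections ⊥ (sq A ⊓ sqOp A) ⊤ bot_le le_top (s3.2 inferInstance)
      (glue_add_sections _ (sq A) ⊤ inf_le_left le_top (s2.2 inferInstance) (s1.2 inferInstance))
    exact wfgt_of_strictMono (fun H : AddSubgroup A => (⟨H, bot_le, le_top⟩ : Set.Icc ⊥ ⊤))
      (fun _ _ h => h)

open SkewBrace in
/-- For a two-sided skew brace, `(A,+)` satisfies the maximum condition on subgroups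
(no infinite strictly ascending chain of subgroups) iff `(A,∘)` does. -/
theorem max_condition_additive_iff_multiplicative (A : Type*) [SkewBrace A]
    (h : IsTwoSided A) :
    (¬ ∃ f : ℕ → AddSubgroup A, StrictMono f) ↔
    (¬ ∃ f : ℕ → Subgroup A, StrictMono f) := by
  exact wfgt_iff_no_chain.trans ((max_wf_iff A h).trans wfgt_iff_no_chain.symm)
end
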